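/- For every p ≥ 0, a permutation σ of length n can be obtained from the identity permutation of length n by at most p right-jumps if and only if σ has at most p non-left-to-right-maxima. Consequently, the minimal number of right-jumps needed to obtain σ from the identity equals the number of non-left-to-right-maxima of σ. -/

import Mathlib

/-- The word `σ₁σ₂…σₙ` of a permutation of `{1,…,n}` (0-indexed). -/
def permWord {n : ℕ} (σ : Equiv.Perm (Fin n)) : List (Fin n) :=
  List.ofFn (fun i => σ i)

/-- `β` is obtained from `α` by one right-jump: one entry is removed and
reinserted at a strictly later position. -/
def RightJump {n : ℕ} (α β : Equiv.Perm (Fin n)) : Prop :=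
  ∃ (l₁ l₂ l₃ : List (Fin n)) (a : Fin n), l₂ ≠ [] ∧
    permWord α = l₁ ++ a :: (l₂ ++ l₃) ∧
    permWord β = l₁ ++ (l₂ ++ a :: l₃)

/-- `ReachIn p α β` : `β` is obtained from `α` by a sequence of exactly `p` right-jumps. -/
def ReachIn {n : ℕ} : ℕ → Equiv.Perm (Fin n) → Equiv.Perm (Fin n) → Prop
  | 0, α, β => α = β
  | p + 1, α, β => ∃ γ, RightJump α γ ∧ ReachIn p γ β

/-- `σᵢ` is a left-to-right maximum of `σ`. -/
def IsLtrMax {n : ℕ} (σ : Equiv.Perm (Fin n)) (i : Fin n) : Prop :=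
  ∀ j, j ≤ i → σ j ≤ σ i

/-- The number of non-left-to-right-maxima of `σ`. -/
noncomputable def nonLtrMaxCount {n : ℕ} (σ : Equiv.Perm (Fin n)) : ℕ :=
  {i : Fin n | ¬ IsLtrMax σ i}.ncard

def Bef {α : Type} (y x : α) : List α → Prop
  | [] => False
  | a :: l => (y = a ∧ x ∈ l) ∨ Bef y x l

theorem bef_nil {α : Type} (y x : α) : Bef y x [] ↔ False := Iff.rfl

theorem bef_cons {α : Type} (y x a : α) (l : List α) :
    Bef y x (a :: l) ↔ (y = a ∧ x ∈ l) ∨ Bef y x l := Iff.rfl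

theorem bef_append {α : Type} (y x : α) (l m : List α) :
    Bef y x (l ++ m) ↔ Bef y x l ∨ (y ∈ l ∧ x ∈ m) ∨ Bef y x m := by
  induction l with
  | nil => simp [bef_nil]
  | cons a l ih => simp only [List.cons_append, bef_cons, ih, List.mem_append, List.mem_cons]; tauto

theorem bef_mem {α : Type} {y x : α} {l : List α} (h : Bef y x l) : y ∈ l ∧ x ∈ l := by
  induction l with
  | nil => exact h.elim
  | cons a l ih =>
    rw [bef_cons] at h
    rcases h with ⟨rfl, h⟩ | h
    · simp [h]
    · simp [ih h]

theorem bef_iff {α : Type} (y x : α) (l : List α) :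
    Bef y x l ↔ ¬ l.Pairwise (fun a b => ¬ (a = y ∧ b = x)) := by
  induction l with
  | nil => simp [bef_nil]
  | cons a l ih =>
    rw [bef_cons, ih, List.pairwise_cons]
    by_cases h : y = a
    · subst h
      by_cases hx : x ∈ l
      · simp only [hx, and_self, true_or, true_iff]
        intro hh
        exact hh.1 x hx (by simp)
      · have : ∀ a' ∈ l, ¬ (True ∧ a' = x) := by
          rintro a' ha' ⟨-, rfl⟩
          exact hx ha'
        simp only [hx, and_false, false_or]
        tauto
    · have : ∀ a' ∈ l, ¬ (a = y ∧ a' = x) := by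
        rintro a' ha' ⟨rfl, -⟩
        exact h rfl
      tauto

theorem bef_permWord {n : ℕ} (σ : Equiv.Perm (Fin n)) (i j : Fin n) :
    Bef (σ i) (σ j) (permWord σ) ↔ i < j := by
  rw [bef_iff, permWord, List.pairwise_ofFn]
  constructor
  · intro h
    by_contra hij
    apply h
    rintro a b hab ⟨h1, h2⟩
    rw [σ.injective h1, σ.injective h2] at hab
    exact hij hab
  · intro h hh
    exact hh h ⟨rfl, rfl⟩

def NSet {n : ℕ} (l : List (Fin n)) : Set (Fin n) := {x | ∃ y, x < y ∧ Bef y x l}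

theorem count_eq {n : ℕ} (σ : Equiv.Perm (Fin n)) :
    nonLtrMaxCount σ = (NSet (permWord σ)).ncard := by
  have : NSet (permWord σ) = σ '' {i : Fin n | ¬ IsLtrMax σ i} := by
    ext x
    obtain ⟨j, rfl⟩ := σ.surjective x
    simp only [NSet, Set.mem_ofPred_eq, σ.injective.mem_set_image, IsLtrMax]
    push Not
    constructor
    · rintro ⟨y, hy, hb⟩
      obtain ⟨i, rfl⟩ := σ.surjective y
      exact ⟨i, ((bef_permWord σ i j).1 hb).le, hy⟩
    · rintro ⟨i, hi, hy⟩
      refine ⟨σ i, hy, (bef_permWord σ i j).2 (lt_of_le_of_ne hi ?_)⟩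
      rintro rfl
      exact lt_irrefl _ hy
  rw [this, Set.ncard_image_of_injective _ σ.injective, nonLtrMaxCount]

theorem nodup_permWord {n : ℕ} (σ : Equiv.Perm (Fin n)) : (permWord σ).Nodup :=
  List.nodup_ofFn.2 σ.injective

theorem jump_le {n : ℕ} {α β : Equiv.Perm (Fin n)} (h : RightJump α β) :
    nonLtrMaxCount β ≤ nonLtrMaxCount α + 1 := by
  obtain ⟨l₁, l₂, l₃, a, -, hα, hβ⟩ := h
  rw [count_eq, count_eq]
  have : NSet (permWord β) ⊆ insert a (NSet (permWord α)) := by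
    rintro x ⟨y, hxy, hb⟩
    rw [Set.mem_insert_iff]
    by_cases hx : x = a
    · exact Or.inl hx
    · refine Or.inr ⟨y, hxy, ?_⟩
      rw [hα]
      rw [hβ] at hb
      simp only [bef_append, bef_cons, List.mem_append, List.mem_cons] at hb ⊢
      tauto
  exact (Set.ncard_le_ncard this (Set.toFinite _)).trans (Set.ncard_insert_le _ _)

theorem reach_snoc {n : ℕ} {p : ℕ} {α γ β : Equiv.Perm (Fin n)} (h : ReachIn p α γ)
    (hj : RightJump γ β) : ReachIn (p + 1) α β := by
  induction p generalizing α with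
  | zero =>
    have h' : α = γ := h
    subst h'
    exact ⟨β, hj, rfl⟩
  | succ p ih =>
    obtain ⟨δ, h1, h2⟩ := h
    exact ⟨δ, h1, ih h2⟩

theorem reach_le {n : ℕ} {p : ℕ} {α β : Equiv.Perm (Fin n)} (h : ReachIn p α β) :
    nonLtrMaxCount β ≤ nonLtrMaxCount α + p := by
  induction p generalizing α with
  | zero =>
    have h' : α = β := h
    subst h'
    simp
  | succ p ih =>
    obtain ⟨δ, h1, h2⟩ := h
    have := ih h2
    have := jump_le h1
    omega

theorem count_one {n : ℕ} : nonLtrMaxCount (1 : Equiv.Perm (Fin n)) = 0 := by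
  have : {i : Fin n | ¬ IsLtrMax (1 : Equiv.Perm (Fin n)) i} = ∅ := by
    ext i
    simp [IsLtrMax]
  rw [nonLtrMaxCount, this, Set.ncard_empty]

theorem eq_one {n : ℕ} {σ : Equiv.Perm (Fin n)} (h : nonLtrMaxCount σ = 0) : σ = 1 := by
  rw [nonLtrMaxCount, Set.ncard_eq_zero (Set.toFinite _)] at h
  have hm : Monotone σ := by
    intro i j hij
    have : j ∉ {i : Fin n | ¬ IsLtrMax σ i} := by rw [h]; simp
    simp only [Set.mem_ofPred_eq, not_not] at this
    exact this i hij
  have hs : StrictMono σ := hm.strictMono_of_injective σ.injective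
  let e : Fin n ≃o Fin n := hs.orderIsoOfSurjective σ σ.surjective
  have he : e = OrderIso.refl _ := Subsingleton.elim _ _
  ext i
  have : e i = i := by rw [he]; rfl
  have h2 : e i = σ i := rfl
  rw [← h2, this]
  rfl

theorem exists_perm {n : ℕ} (l : List (Fin n)) (hl : l.Nodup) (hn : l.length = n) :
    ∃ α : Equiv.Perm (Fin n), permWord α = l := by
  have hi : Function.Injective (fun i : Fin n => l.get (i.cast hn.symm)) := by
    intro i j hij
    have := (List.nodup_iff_injective_get.1 hl) hij
    simpa using this
  refine ⟨Equiv.ofBijective _ (Finite.injective_iff_bijective.1 hi), ?_⟩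
  apply List.ext_get
  · simp [permWord, hn]
  · intro k h1 h2
    simp [permWord]

theorem split_first {n : ℕ} (a : Fin n) (m : List (Fin n)) (h : ∃ y ∈ m, a < y) :
    ∃ l₁ y l₂, m = l₁ ++ y :: l₂ ∧ a < y ∧ ∀ x ∈ l₁, x ≤ a := by
  induction m with
  | nil => simp at h
  | cons b m ih =>
    by_cases hb : a < b
    · exact ⟨[], b, m, rfl, hb, by simp⟩
    · have : ∃ y ∈ m, a < y := by
        obtain ⟨y, hy, hay⟩ := h
        rcases List.mem_cons.1 hy with rfl | hy
        · exact absurd hay hb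
        · exact ⟨y, hy, hay⟩
      obtain ⟨l₁, y, l₂, rfl, h1, h2⟩ := ih this
      refine ⟨b :: l₁, y, l₂, rfl, h1, ?_⟩
      intro x hx
      rcases List.mem_cons.1 hx with rfl | hx
      · exact not_lt.1 hb
      · exact h2 x hx

theorem exists_prev {n : ℕ} {σ : Equiv.Perm (Fin n)} (h : nonLtrMaxCount σ ≠ 0) :
    ∃ α, RightJump α σ ∧ nonLtrMaxCount α < nonLtrMaxCount σ := by
  rw [count_eq] at h
  obtain ⟨a, z, haz, hb⟩ := Set.nonempty_of_ncard_ne_zero h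
  have hnd := nodup_permWord σ
  have ha : a ∈ permWord σ := (bef_mem hb).2
  obtain ⟨m, l₃, hm⟩ := List.append_of_mem ha
  have hz : z ∈ m := by
    rw [hm] at hb hnd
    rw [bef_append, bef_cons] at hb
    rcases hb with hb | ⟨hb, -⟩ | ⟨rfl, hb⟩ | hb
    · exact (bef_mem hb).1
    · exact hb
    · exact absurd haz (lt_irrefl _)
    · have := (bef_mem hb).2
      rw [List.nodup_append, List.nodup_cons] at hnd
      exact absurd this hnd.2.1.1
  obtain ⟨l₁, y, l₂, rfl, hay, hl₁⟩ := split_first a m ⟨z, hz, haz⟩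
  have hp : (l₁ ++ a :: ((y :: l₂) ++ l₃)).Perm (permWord σ) := by
    rw [hm, List.append_assoc]
    exact List.Perm.append_left _ List.perm_middle.symm
  have hnd' := hp.nodup_iff.2 hnd
  obtain ⟨α, hα⟩ := exists_perm _ hnd' (by rw [hp.length_eq]; simp [permWord])
  refine ⟨α, ⟨l₁, y :: l₂, l₃, a, by simp, hα, by rw [hm, List.append_assoc]⟩, ?_⟩
  rw [count_eq, count_eq]
  have hain : a ∈ NSet (permWord σ) := ⟨z, haz, hb⟩
  apply Set.ncard_lt_ncard _ (Set.toFinite _)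
  rw [Set.ssubset_iff_of_subset]
  · refine ⟨a, hain, ?_⟩
    rintro ⟨w, haw, hw⟩
    rw [hα, bef_append, bef_cons] at hw
    rw [List.nodup_append, List.nodup_cons] at hnd'
    rcases hw with hw | ⟨hw, -⟩ | ⟨rfl, hw⟩ | hw
    · exact absurd haw (not_lt.2 (hl₁ _ (bef_mem hw).1))
    · exact absurd haw (not_lt.2 (hl₁ _ hw))
    · exact lt_irrefl _ haw
    · exact hnd'.2.1.1 (bef_mem hw).2
  · rintro x ⟨w, hxw, hw⟩
    by_cases hxa : x = a
    · rw [hxa]; exact hain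
    by_cases hwa : w = a
    · subst hwa
      have hxy : x < y := hxw.trans hay
      by_cases hx : x ∈ l₂ ++ l₃
      · refine ⟨y, hxy, ?_⟩
        rw [hm]
        simp only [bef_append, bef_cons, List.mem_append, List.mem_cons] at hx ⊢
        tauto
      · exfalso
        have h3 : ∀ u, Bef u x l₁ → u ≤ w := fun u hu => hl₁ _ (bef_mem hu).1
        have hwl : w ∉ l₁ := by
          intro hwl
          rw [List.nodup_append] at hnd'
          exact hnd'.2.2 w hwl w (by simp) rfl
        rw [hα, bef_append, bef_cons] at hw
        have hne : x ≠ y := hxy.ne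
        have hwr : w ∉ (y :: l₂) ++ l₃ := by
          rw [List.nodup_append, List.nodup_cons] at hnd'
          exact hnd'.2.1.1
        rcases hw with hw | ⟨hw, -⟩ | ⟨-, hw⟩ | hw
        · exact hwl (bef_mem hw).1
        · exact hwl hw
        · simp only [List.cons_append, List.mem_cons] at hw
          tauto
        · exact hwr (bef_mem hw).1
    · refine ⟨w, hxw, ?_⟩
      rw [hα] at hw
      rw [hm]
      simp only [bef_append, bef_cons, List.mem_append, List.mem_cons, List.cons_append] at hw ⊢
      tauto

theorem exists_reach {n : ℕ} (k : ℕ) (σ : Equiv.Perm (Fin n)) (h : nonLtrMaxCount σ ≤ k) :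
    ∃ q ≤ nonLtrMaxCount σ, ReachIn q 1 σ := by
  induction k generalizing σ with
  | zero =>
    have := eq_one (Nat.le_zero.1 h)
    subst this
    exact ⟨0, Nat.zero_le _, rfl⟩
  | succ k ih =>
    by_cases h0 : nonLtrMaxCount σ = 0
    · exact ih σ (by omega)
    · obtain ⟨α, hj, hlt⟩ := exists_prev h0
      obtain ⟨q, hq, hr⟩ := ih α (by omega)
      exact ⟨q + 1, by omega, reach_snoc hr hj⟩

/-- `σ` can be obtained from the identity by at most `p` right-jumps iff `σ`
has at most `p` non-left-to-right-maxima; consequently the minimal number of right-jumps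
needed to obtain `σ` from the identity equals its number of non-left-to-right-maxima. -/
theorem reachable_iff_nonLtrMaxCount_le (n : ℕ) (σ : Equiv.Perm (Fin n)) :
    (∀ p : ℕ, (∃ q ≤ p, ReachIn q 1 σ) ↔ nonLtrMaxCount σ ≤ p) ∧
    IsLeast {q : ℕ | ReachIn q 1 σ} (nonLtrMaxCount σ) := by
  have low : ∀ q, ReachIn q 1 σ → nonLtrMaxCount σ ≤ q := by
    intro q hq
    have := reach_le hq
    rw [count_one] at this
    omega
  obtain ⟨q, hq, hr⟩ := exists_reach _ σ le_rfl
  have hqe : q = nonLtrMaxCount σ := le_antisymm hq (low q hr)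
  subst hqe
  refine ⟨fun p => ⟨?_, fun h => ⟨_, h, hr⟩⟩, hr, fun q hq => low q hq⟩
  rintro ⟨q, hqp, hq⟩
  exact (low q hq).trans hqp
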